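/- Let N ≥ 2 be an integer, p_c = 1/N and q_c = p_c·(1-p_c)^(N-1). For B ∈ (0, q_c), L, M ≥ 1 and p_d ∈ [0,1], define q_d(p_d) = p_c·(1-p_c)^(N-2)·(1-p_d), P_f(B,L) = 1 − (1 − F(L·(q_c−B); L, q_c))^N, P_m(B,L;p_d) = (1 − F(L·(q_c−B); L, q_d(p_d)))^(N-1), U_rr = ((1-p_c)^(N-1)/(L+M)) · (p_c·L + p_c·(1-P_f(B,L))·M + ((1-P_f(B,L))^((N-1)/N) · (1-(1-P_f(B,L))^(1/N)))·M), U_dr(p_d) = p_d·(1-p_c)^(N-1)·(L + P_m(B,L;p_d)·M)/(L+M), and C = N·p_c·(1-p_c)^(N-1) − N·U_rr, where F(y;n,p) = Σ_{m=0}^{⌊y⌋} C(n,m)·p^m·(1-p)^(n-m). Then for every ε > 0 and δ > 0, there exist B ∈ (0, q_c) and natural numbers L, M ≥ 1 such that U_dr(p_d) ≤ U_rr + ε for all p_d ∈ [0,1], and C ≤ δ. -/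

import Mathlib

/-- Binomial cumulative distribution function `F(y; n, p) = ∑_{m=0}^{⌊y⌋} C(n,m) p^m (1-p)^(n-m)`. -/
noncomputable def binCDF (y : ℝ) (n : ℕ) (p : ℝ) : ℝ :=
  ∑ m ∈ Finset.range (n + 1),
    if (m : ℝ) ≤ y then (n.choose m : ℝ) * p ^ m * (1 - p) ^ (n - m) else 0

lemma wt_nonneg (n m : ℕ) (p : ℝ) (h0 : 0 ≤ p) (h1 : p ≤ 1) :
    0 ≤ (n.choose m : ℝ) * p ^ m * (1 - p) ^ (n - m) := by
  have : 0 ≤ 1 - p := by linarith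
  positivity

lemma wt_sum (n : ℕ) (p : ℝ) :
    ∑ m ∈ Finset.range (n + 1), (n.choose m : ℝ) * p ^ m * (1 - p) ^ (n - m) = 1 := by
  have := congrArg (Polynomial.eval p) (bernsteinPolynomial.sum ℝ n)
  simpa [bernsteinPolynomial, Polynomial.eval_finsetSum] using this

lemma wt_var (n : ℕ) (p : ℝ) :
    ∑ m ∈ Finset.range (n + 1), ((n : ℝ) * p - m) ^ 2 *
      ((n.choose m : ℝ) * p ^ m * (1 - p) ^ (n - m)) = n * p * (1 - p) := by
  have := congrArg (Polynomial.eval p) (bernsteinPolynomial.variance ℝ n)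
  simpa [bernsteinPolynomial, Polynomial.eval_finsetSum] using this

lemma wt_var_le (n : ℕ) (p : ℝ) (h0 : 0 ≤ p) (h1 : p ≤ 1) :
    ∑ m ∈ Finset.range (n + 1), ((n : ℝ) * p - m) ^ 2 *
      ((n.choose m : ℝ) * p ^ m * (1 - p) ^ (n - m)) ≤ (n : ℝ) := by
  rw [wt_var]
  have : (0 : ℝ) ≤ n := by positivity
  have h2 : p * (1 - p) ≤ 1 := by nlinarith
  nlinarith

lemma binCDF_nonneg (y : ℝ) (n : ℕ) (p : ℝ) (h0 : 0 ≤ p) (h1 : p ≤ 1) :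
    0 ≤ binCDF y n p := by
  unfold binCDF
  apply Finset.sum_nonneg
  intro m _
  split_ifs
  · exact wt_nonneg n m p h0 h1
  · exact le_rfl

lemma one_sub_binCDF (y : ℝ) (n : ℕ) (p : ℝ) :
    1 - binCDF y n p = ∑ m ∈ Finset.range (n + 1),
      if (m : ℝ) ≤ y then 0 else (n.choose m : ℝ) * p ^ m * (1 - p) ^ (n - m) := by
  unfold binCDF
  rw [sub_eq_iff_eq_add, ← Finset.sum_add_distrib]
  refine (wt_sum n p).symm.trans (Finset.sum_congr rfl ?_)
  intro m _
  split_ifs <;> simp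

lemma binCDF_le_one (y : ℝ) (n : ℕ) (p : ℝ) (h0 : 0 ≤ p) (h1 : p ≤ 1) :
    binCDF y n p ≤ 1 := by
  rw [← sub_nonneg, one_sub_binCDF]
  apply Finset.sum_nonneg
  intro m _
  split_ifs
  · exact le_rfl
  · exact wt_nonneg n m p h0 h1

lemma lower_tail (y t : ℝ) (n : ℕ) (p : ℝ) (h0 : 0 ≤ p) (h1 : p ≤ 1) (ht : 0 ≤ t)
    (hy : y ≤ n * p - t) : t ^ 2 * binCDF y n p ≤ n := by
  refine le_trans ?_ (wt_var_le n p h0 h1)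
  unfold binCDF
  rw [Finset.mul_sum]
  apply Finset.sum_le_sum
  intro m _
  have hw := wt_nonneg n m p h0 h1
  split_ifs with h
  · apply mul_le_mul_of_nonneg_right _ hw
    apply pow_le_pow_left₀ ht
    linarith
  · rw [mul_zero]; positivity

lemma upper_tail (y t : ℝ) (n : ℕ) (p : ℝ) (h0 : 0 ≤ p) (h1 : p ≤ 1) (ht : 0 ≤ t)
    (hy : n * p + t ≤ y) : t ^ 2 * (1 - binCDF y n p) ≤ n := by
  refine le_trans ?_ (wt_var_le n p h0 h1)
  rw [one_sub_binCDF, Finset.mul_sum]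
  apply Finset.sum_le_sum
  intro m _
  have hw := wt_nonneg n m p h0 h1
  split_ifs with h
  · rw [mul_zero]; positivity
  · apply mul_le_mul_of_nonneg_right _ hw
    push Not at h
    nlinarith

/-- For every `ε > 0` and `δ > 0` there exist a margin of error `B ∈ (0, q_c)`
and lengths `L, M ≥ 1` such that the review protocol based on the ACK ratio test is robust
`ε`-deviation-proof (against every constant deviation probability `p_d ∈ [0,1]`) and
`δ`-Pareto optimal. -/
theorem stmt7 (N : ℕ) (hN : 2 ≤ N)
    (pc qc : ℝ) (hpc : pc = 1 / N)
    (hqc : qc = pc * (1 - pc) ^ (N - 1))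
    (qd : ℝ → ℝ) (hqd : ∀ p_d, qd p_d = pc * (1 - pc) ^ (N - 2) * (1 - p_d))
    (Pf : ℝ → ℕ → ℝ) (Pm : ℝ → ℕ → ℝ → ℝ)
    (hPf : ∀ B L, Pf B L = 1 - (1 - binCDF ((L : ℝ) * (qc - B)) L qc) ^ N)
    (hPm : ∀ B L p_d,
      Pm B L p_d = (1 - binCDF ((L : ℝ) * (qc - B)) L (qd p_d)) ^ (N - 1))
    (Urr : ℝ → ℕ → ℕ → ℝ) (Udr : ℝ → ℕ → ℕ → ℝ → ℝ) (C : ℝ → ℕ → ℕ → ℝ)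
    (hUrr : ∀ B L M, Urr B L M = ((1 - pc) ^ (N - 1) / ((L : ℝ) + M)) *
      (pc * L + pc * (1 - Pf B L) * M +
        ((1 - Pf B L) ^ (((N : ℝ) - 1) / N) * (1 - (1 - Pf B L) ^ ((1 : ℝ) / N))) * M))
    (hUdr : ∀ B L M p_d, Udr B L M p_d =
      p_d * (1 - pc) ^ (N - 1) * ((L : ℝ) + Pm B L p_d * M) / ((L : ℝ) + M))
    (hC : ∀ B L M, C B L M = N * pc * (1 - pc) ^ (N - 1) - N * Urr B L M) :
    ∀ ε δ : ℝ, 0 < ε → 0 < δ →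
      ∃ B ∈ Set.Ioo (0 : ℝ) qc, ∃ L M : ℕ, 1 ≤ L ∧ 1 ≤ M ∧
        (∀ p_d ∈ Set.Icc (0 : ℝ) 1, Udr B L M p_d ≤ Urr B L M + ε) ∧
        C B L M ≤ δ := by
  intro ε δ hε hδ
  have hN2 : (2 : ℝ) ≤ N := by exact_mod_cast hN
  have hN0 : (0 : ℝ) < N := by linarith
  have hpc0 : 0 < pc := by rw [hpc]; positivity
  have hNpc : N * pc = 1 := by rw [hpc]; field_simp
  have hpc1 : pc < 1 := by nlinarith
  have h1pc : 0 < 1 - pc := by linarith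
  obtain ⟨a, ha⟩ : ∃ a, a = (1 - pc) ^ (N - 1) := ⟨_, rfl⟩
  have ha0 : 0 < a := by rw [ha]; positivity
  have ha1 : a ≤ 1 := by rw [ha]; exact pow_le_one₀ h1pc.le (by linarith)
  obtain ⟨k, hk⟩ : ∃ k, k = pc * (1 - pc) ^ (N - 2) := ⟨_, rfl⟩
  have hk0 : 0 < k := by rw [hk]; positivity
  have hk1 : k ≤ 1 := by
    rw [hk]; exact mul_le_one₀ hpc1.le (by positivity) (pow_le_one₀ h1pc.le (by linarith))
  have hqk : qc = k * (1 - pc) := by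
    rw [hqc, hk, mul_assoc, ← pow_succ]; congr 2; omega
  rw [← ha] at hqc
  have hqc0 : 0 < qc := by rw [hqc]; positivity
  have hqc1 : qc ≤ 1 := by rw [hqc]; nlinarith
  simp only [← hk] at hqd
  simp only [← ha] at hUrr hUdr hC
  -- choice of B
  obtain ⟨B, hB0, hBq, hBk⟩ : ∃ B : ℝ, 0 < B ∧ B < qc ∧ 2 * B ≤ k * (ε / 2) := by
    refine ⟨min (qc / 2) (k * (ε / 4)), by positivity, ?_, ?_⟩
    · exact lt_of_le_of_lt (min_le_left _ _) (by linarith)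
    · have := min_le_right (qc / 2) (k * (ε / 4)); linarith
  -- choice of η
  obtain ⟨η, hη0, hη1, hηε, hηδ⟩ :
      ∃ η : ℝ, 0 < η ∧ η ≤ 1 ∧ η ≤ ε / 4 ∧ N * η ≤ δ := by
    refine ⟨min 1 (min (ε / 4) (δ / N)), by positivity, min_le_left _ _, ?_, ?_⟩
    · exact (min_le_right _ _).trans (min_le_left _ _)
    · have : min 1 (min (ε / 4) (δ / N)) ≤ δ / N := (min_le_right _ _).trans (min_le_right _ _)
      rw [le_div_iff₀ hN0] at this; linarith
  -- choice of L
  obtain ⟨L, hL⟩ := exists_nat_ge (1 / (η * B ^ 2) + 1)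
  have hx : 0 < 1 / (η * B ^ 2) := by positivity
  have hL1 : (1 : ℝ) ≤ L := by linarith
  have hLB : 1 ≤ L * (η * B ^ 2) := by
    rw [← div_le_iff₀ (by positivity)]; linarith
  have hcheb : ∀ x : ℝ, (L * B) ^ 2 * x ≤ L → x ≤ η := by
    intro x hx
    by_contra hlt
    push Not at hlt
    have hp : 0 < ((L : ℝ) * B) ^ 2 := by positivity
    have h1 := mul_lt_mul_of_pos_left hlt hp
    have h2 : (L : ℝ) * 1 ≤ L * (L * (η * B ^ 2)) := mul_le_mul_of_nonneg_left hLB (by linarith)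
    have e : ((L : ℝ) * B) ^ 2 * η = L * (L * (η * B ^ 2)) := by ring
    linarith
  -- choice of M
  obtain ⟨M, hM⟩ := exists_nat_ge ((L : ℝ) / (ε / 4) + 1)
  have hx2 : 0 < (L : ℝ) / (ε / 4) := by positivity
  have hM1 : (1 : ℝ) ≤ M := by linarith
  have hLM : (L : ℝ) ≤ M * (ε / 4) := by
    rw [← div_le_iff₀ (by positivity)]; linarith
  have hS : (0 : ℝ) < L + M := by linarith
  -- Urr
  have hF0 := binCDF_nonneg (L * (qc - B)) L qc hqc0.le hqc1
  have hF1 := binCDF_le_one (L * (qc - B)) L qc hqc0.le hqc1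
  have hFη : binCDF (L * (qc - B)) L qc ≤ η :=
    hcheb _ (lower_tail _ (L * B) L qc hqc0.le hqc1 (by positivity) (by linarith))
  have hPf1 : 1 - Pf B L = (1 - binCDF (L * (qc - B)) L qc) ^ N := by rw [hPf]; ring
  have hR0 : 0 ≤ 1 - Pf B L := by rw [hPf1]; exact pow_nonneg (by linarith) _
  have hR1 : 1 - Pf B L ≤ 1 := by rw [hPf1]; exact pow_le_one₀ (by linarith) (by linarith)
  have hRη : 1 - N * η ≤ 1 - Pf B L := by
    rw [hPf1]
    have := one_add_mul_le_pow (a := -binCDF (L * (qc - B)) L qc) (by linarith) N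
    rw [sub_eq_add_neg 1 (binCDF _ _ _)]
    have h2 := mul_le_mul_of_nonneg_left hFη hN0.le
    linarith
  have hU : pc * a - η ≤ Urr B L M := by
    rw [hUrr]
    have h3 : 0 ≤ (1 - Pf B L) ^ (((N : ℝ) - 1) / N) * (1 - (1 - Pf B L) ^ ((1 : ℝ) / N)) := by
      apply mul_nonneg (Real.rpow_nonneg hR0 _)
      have := Real.rpow_le_one hR0 hR1 (z := (1 : ℝ) / N) (by positivity)
      linarith
    have h4 : pc - η ≤ pc * (1 - Pf B L) := by
      have := mul_le_mul_of_nonneg_left hRη hpc0.le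
      have e : pc * (1 - N * η) = pc - (N * pc) * η := by ring
      rw [e, hNpc] at this; linarith
    have h5 : (pc - η) * (L + M) ≤ pc * L + pc * (1 - Pf B L) * M +
        ((1 - Pf B L) ^ (((N : ℝ) - 1) / N) * (1 - (1 - Pf B L) ^ ((1 : ℝ) / N))) * M := by
      have h6 := mul_le_mul_of_nonneg_right h4 (by linarith : (0 : ℝ) ≤ M)
      have h7 := mul_nonneg h3 (by linarith : (0 : ℝ) ≤ M)
      have h10 : 0 ≤ η * (L : ℝ) := by positivity
      linarith
    have h8 := mul_le_mul_of_nonneg_left h5 (by positivity : 0 ≤ a / ((L : ℝ) + M))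
    refine le_trans ?_ h8
    have e : a / ((L : ℝ) + M) * ((pc - η) * (L + M)) = a * (pc - η) := by field_simp
    rw [e]
    have h9 := mul_le_mul_of_nonneg_right ha1 hη0.le
    linarith
  refine ⟨B, ⟨hB0, hBq⟩, L, M, by exact_mod_cast hL1, by exact_mod_cast hM1, ?_, ?_⟩
  · rintro p ⟨hp0, hp1⟩
    have hq0 : 0 ≤ qd p := by rw [hqd]; exact mul_nonneg hk0.le (by linarith)
    have hq1 : qd p ≤ 1 := by rw [hqd]; nlinarith
    have hG0 := binCDF_nonneg (L * (qc - B)) L (qd p) hq0 hq1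
    have hG1 := binCDF_le_one (L * (qc - B)) L (qd p) hq0 hq1
    have hPm1 : Pm B L p ≤ 1 := by rw [hPm]; exact pow_le_one₀ (by linarith) (by linarith)
    have hPm0 : 0 ≤ Pm B L p := by rw [hPm]; exact pow_nonneg (by linarith) _
    rw [hUdr]
    by_cases hc : p ≤ pc + ε / 2
    · have h1 : p * a * (L + Pm B L p * M) / (L + M) ≤ p * a := by
        rw [div_le_iff₀ hS]
        apply mul_le_mul_of_nonneg_left _ (by positivity)
        have := mul_le_mul_of_nonneg_right hPm1 (by linarith : (0 : ℝ) ≤ M)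
        linarith
      have h2 := mul_le_mul_of_nonneg_right hc ha0.le
      have h3 : ε / 2 * a ≤ ε / 2 * 1 := mul_le_mul_of_nonneg_left ha1 (by linarith)
      linarith
    · push Not at hc
      have hgap : qd p + 2 * B ≤ qc := by
        rw [hqd, hqk]
        have := mul_le_mul_of_nonneg_left hc.le hk0.le
        linarith
      have hGη : 1 - binCDF (L * (qc - B)) L (qd p) ≤ η :=
        hcheb _ (upper_tail _ (L * B) L (qd p) hq0 hq1 (by positivity) (by
          have := mul_le_mul_of_nonneg_left hgap (by linarith : (0 : ℝ) ≤ L)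
          linarith))
      have hPmη : Pm B L p ≤ η := by
        rw [hPm]
        exact (pow_le_of_le_one (by linarith) (by linarith) (by omega)).trans hGη
      have h1 : p * a * (L + Pm B L p * M) / (L + M) ≤ ε / 4 + η := by
        rw [div_le_iff₀ hS]
        have h2 : p * a ≤ 1 := mul_le_one₀ hp1 ha0.le ha1
        have h3 : 0 ≤ L + Pm B L p * M := by positivity
        have h4 := mul_le_mul_of_nonneg_right h2 h3
        have h5 := mul_le_mul_of_nonneg_right hPmη (by linarith : (0 : ℝ) ≤ M)
        have h6 : 0 ≤ (L : ℝ) * (ε / 4 + η) := by positivity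
        linarith
      have : 0 < pc * a := by positivity
      linarith
  · rw [hC]
    have := mul_le_mul_of_nonneg_left hU hN0.le
    linarith
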